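/- Let A be a bounded self-adjoint operator on a Hilbert space and P a self-adjoint projection with ‖A − P‖ < 1/2. Then A maps im(P) injectively onto a closed subspace. -/

import Mathlib

/-- If `A` is a bounded self-adjoint operator on a complex Hilbert space and
`P` is a self-adjoint (orthogonal) projection with `‖A − P‖ < 1/2`, then `A` maps `im P`
injectively onto a closed subspace. -/
theorem stmt1 {H : Type*} [NormedAddCommGroup H] [InnerProductSpace ℂ H] [CompleteSpace H]
    (A P : H →L[ℂ] H)
    (hA : IsSelfAdjoint A)
    (hPsa : IsSelfAdjoint P) (hPidem : P * P = P)
    (hnorm : ‖A - P‖ < 1 / 2) :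
    Set.InjOn A (Set.range P) ∧ IsClosed (A '' Set.range P) := by
  have hfix : ∀ x ∈ Set.range P, P x = x := by
    rintro _ ⟨y, rfl⟩
    exact congrArg (fun T : H →L[ℂ] H => T y) hPidem
  have hclosed : IsClosed (Set.range P) := by
    have h : Set.range P = {x | P x = x} := by
      ext x
      exact ⟨hfix x, fun h => ⟨x, h⟩⟩
    rw [h]
    exact isClosed_eq P.continuous continuous_id
  have hanti : AntilipschitzWith 2 (fun x : Set.range P => A x) := by
    refine AntilipschitzWith.of_le_mul_dist ?_
    rintro ⟨x, hx⟩ ⟨y, hy⟩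
    have h1 : P (x - y) = x - y := by rw [map_sub, hfix x hx, hfix y hy]
    have h2 : ‖(A - P) (x - y)‖ ≤ 1 / 2 * ‖x - y‖ :=
      ((A - P).le_opNorm _).trans (by gcongr)
    have h3 : x - y = A (x - y) - (A - P) (x - y) := by
      rw [ContinuousLinearMap.sub_apply, h1]; abel
    have h4 : ‖x - y‖ ≤ ‖A (x - y)‖ + ‖(A - P) (x - y)‖ := by
      conv_lhs => rw [h3]
      exact norm_sub_le _ _
    rw [Subtype.dist_eq, dist_eq_norm, dist_eq_norm, ← map_sub]
    push_cast
    linarith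
  refine ⟨Set.injOn_iff_injective.mpr hanti.injective, ?_⟩
  have : CompleteSpace (Set.range P) := hclosed.completeSpace_coe
  have h := hanti.isClosed_range (A.uniformContinuous.comp uniformContinuous_subtype_val)
  rw [Set.image_eq_range]
  exact h
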